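/- (Policy Gradient Theorem, returns-to-go form.) For the finite-horizon MDP and parameterized policy described in the context, the gradient of the value satisfies ∇_θ V(θ) = Σ_τ P_θ(τ) · Σ_{t=0}^{H−1} ∇_θ log π_θ(a_t | s_t) · G_t(τ), where G_t(τ) = Σ_{t'=t}^{H−1} γ^{t'} · r(s_{t'}, a_{t'}) is the (discounted) return from time t onward, and the outer sum ranges over all trajectories τ. -/

import Mathlib

open Finset

noncomputable section

/-- A trajectory of horizon `H`: an initial state together with `H` (action, next-state)
pairs, i.e. an element of `S × (A × S)^H`. -/
abbrev Traj (S A : Type*) (H : ℕ) := S × (Fin H → A × S)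

/-- The state `s_t` visited at time `t ≤ H` along a trajectory. -/
def trajState {S A : Type*} {H : ℕ} (τ : Traj S A H) (t : Fin (H + 1)) : S :=
  if h : (t : ℕ) = 0 then τ.1
  else (τ.2 ⟨(t : ℕ) - 1, by have := t.isLt; omega⟩).2

/-- The action `a_t` taken at time `t < H` along a trajectory. -/
def trajAction {S A : Type*} {H : ℕ} (τ : Traj S A H) (t : Fin H) : A := (τ.2 t).1

/-- The probability `P_θ(τ) = p₀(s₀) ∏_t π_θ(a_t|s_t) P(s_t, a_t, s_{t+1})`. -/
def trajProb {S A : Type*} {d H : ℕ} (p0 : S → ℝ) (P : S → A → S → ℝ)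
    (pol : (Fin d → ℝ) → S → A → ℝ) (θ : Fin d → ℝ) (τ : Traj S A H) : ℝ :=
  p0 (trajState τ 0) *
    ∏ t : Fin H, pol θ (trajState τ t.castSucc) (trajAction τ t) *
      P (trajState τ t.castSucc) (trajAction τ t) (trajState τ t.succ)

/-- The discounted return `R(τ) = Σ_t γ^t r(s_t, a_t)`. -/
def trajReturn {S A : Type*} {H : ℕ} (r : S → A → ℝ) (γ : ℝ) (τ : Traj S A H) : ℝ :=
  ∑ t : Fin H, γ ^ (t : ℕ) * r (trajState τ t.castSucc) (trajAction τ t)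

/-- The value `V(θ) = Σ_τ P_θ(τ) R(τ)`. -/
def value {S A : Type*} [Fintype S] [Fintype A] [DecidableEq A] [DecidableEq S]
    {d : ℕ} (H : ℕ) (p0 : S → ℝ) (P : S → A → S → ℝ)
    (pol : (Fin d → ℝ) → S → A → ℝ) (r : S → A → ℝ) (γ : ℝ) (θ : Fin d → ℝ) : ℝ :=
  ∑ τ : Traj S A H, trajProb p0 P pol θ τ * trajReturn r γ τ

/-- The discounted return from time `t` onward: `G_t(τ) = Σ_{t' ≥ t} γ^{t'} r(s_{t'}, a_{t'})`. -/
def returnToGo {S A : Type*} {H : ℕ} (r : S → A → ℝ) (γ : ℝ) (τ : Traj S A H)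
    (t : Fin H) : ℝ :=
  ∑ t' ∈ Finset.univ.filter (fun t' : Fin H => t ≤ t'),
    γ ^ (t' : ℕ) * r (trajState τ t'.castSucc) (trajAction τ t')

/-- Prepending a step `(a, s')` shifts the later states of a trajectory by one. -/
lemma trajState_cons_succ {S A : Type*} {H : ℕ} (s : S) (y : A × S) (x : Fin H → A × S)
    (t : Fin (H + 1)) :
    trajState (H := H + 1) (s, Fin.cons y x) t.succ = trajState (y.2, x) t := by
  cases t using Fin.cases with
  | zero => simp only [trajState]; rfl
  | succ u => simp only [trajState]; rfl

/-- The product of time-dependent weights along a trajectory. -/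
def trajWeight {S A : Type*} {H : ℕ} (w : Fin H → S → A → S → ℝ) (τ : Traj S A H) : ℝ :=
  ∏ t : Fin H, w t (trajState τ t.castSucc) (trajAction τ t) (trajState τ t.succ)

lemma trajWeight_cons {S A : Type*} {H : ℕ} (w : Fin (H + 1) → S → A → S → ℝ) (s : S)
    (y : A × S) (x : Fin H → A × S) :
    trajWeight w (s, Fin.cons y x) =
      w 0 s y.1 y.2 * trajWeight (fun t => w t.succ) (y.2, x) := by
  rw [trajWeight, Fin.prod_univ_succ]
  congr 1
  refine Finset.prod_congr rfl fun t _ => ?_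
  rw [← Fin.succ_castSucc, trajState_cons_succ, trajState_cons_succ]
  rfl

lemma sum_trajWeight_succ {S A : Type*} [Fintype S] [Fintype A] {H : ℕ}
    (w : Fin (H + 1) → S → A → S → ℝ) (s : S) :
    ∑ x, trajWeight w (s, x) =
      ∑ a, ∑ s', w 0 s a s' * ∑ x, trajWeight (fun t => w t.succ) (s', x) := by
  rw [← (Fin.consEquiv fun _ => A × S).sum_comp, Fintype.sum_prod_type, Fintype.sum_prod_type]
  simp only [Finset.mul_sum]
  exact Finset.sum_congr rfl fun a _ => Finset.sum_congr rfl fun s' _ =>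
    Finset.sum_congr rfl fun x _ => trajWeight_cons w s (a, s') x

/-- If every weight is normalized, the total weight of the continuations of a state is `1`. -/
lemma sum_trajWeight_eq_one {S A : Type*} [Fintype S] [Fintype A] {H : ℕ}
    (w : Fin H → S → A → S → ℝ) (hw : ∀ t s, ∑ a, ∑ s', w t s a s' = 1) (s : S) :
    ∑ x, trajWeight w (s, x) = 1 := by
  induction H generalizing s with
  | zero => simp [trajWeight]
  | succ H ih =>
    rw [sum_trajWeight_succ]
    simp only [ih (fun t => w t.succ) (fun t => hw t.succ), mul_one, hw]

/-- If the weight at time `t` sums to zero and all later weights are normalized, the total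
weight of the continuations of a state vanishes. -/
lemma sum_trajWeight_eq_zero {S A : Type*} [Fintype S] [Fintype A] {H : ℕ}
    (w : Fin H → S → A → S → ℝ) (t : Fin H) (ht : ∀ s, ∑ a, ∑ s', w t s a s' = 0)
    (hw : ∀ u, t < u → ∀ s, ∑ a, ∑ s', w u s a s' = 1) (s : S) :
    ∑ x, trajWeight w (s, x) = 0 := by
  induction H generalizing s with
  | zero => exact t.elim0
  | succ H ih =>
    rw [sum_trajWeight_succ]
    cases t using Fin.cases with
    | zero =>
      simp only [sum_trajWeight_eq_one (fun u => w u.succ) (fun u => hw u.succ u.succ_pos),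
        mul_one, ht]
    | succ t =>
      simp only [ih (fun u => w u.succ) t ht fun u hu => hw u.succ (Fin.succ_lt_succ_iff.2 hu),
        mul_zero, Finset.sum_const_zero]

/-- A factor of mean zero under the policy at time `t` annihilates any factor depending on the
state and action of an earlier time `u`. -/
lemma sum_trajProb_mul_earlier_mul_eq_zero {S A : Type*} [Fintype S] [Fintype A] {d H : ℕ}
    (p0 : S → ℝ) (P : S → A → S → ℝ) (hPsum : ∀ s a, ∑ s', P s a s' = 1)
    (pol : (Fin d → ℝ) → S → A → ℝ) (θ : Fin d → ℝ) (hsum : ∀ s, ∑ a, pol θ s a = 1)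
    (c g : S → A → ℝ) (hg : ∀ s, ∑ a, pol θ s a * g s a = 0) {u t : Fin H} (hut : u < t) :
    ∑ τ : Traj S A H, trajProb p0 P pol θ τ *
      (c (trajState τ u.castSucc) (trajAction τ u) *
        g (trajState τ t.castSucc) (trajAction τ t)) = 0 := by
  let w : Fin H → S → A → S → ℝ := fun i s a s' =>
    pol θ s a * P s a s' * ((if i = u then c s a else 1) * if i = t then g s a else 1)
  have hτ : ∀ τ : Traj S A H, trajProb p0 P pol θ τ *
      (c (trajState τ u.castSucc) (trajAction τ u) *
        g (trajState τ t.castSucc) (trajAction τ t)) = p0 τ.1 * trajWeight w τ := by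
    intro τ
    have h0 : trajState τ 0 = τ.1 := by simp [trajState]
    simp only [trajProb, trajWeight, w, Finset.prod_mul_distrib, Finset.prod_ite_eq',
      Finset.mem_univ, if_true, h0]
    ring
  have hw : ∀ s, ∑ x, trajWeight w (s, x) = 0 := by
    refine sum_trajWeight_eq_zero w t (fun s => ?_) (fun i hi s => ?_)
    · simp only [w, hut.ne', if_false, if_true, one_mul, ← Finset.sum_mul, ← Finset.mul_sum,
        hPsum, mul_one, hg]
    · simp only [w, hi.ne', (hut.trans hi).ne', if_false, mul_one, ← Finset.mul_sum, hPsum, hsum]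
  simp only [hτ, Fintype.sum_prod_type, ← Finset.mul_sum, hw, mul_zero, Finset.sum_const_zero]

/-- The log-derivative trick for a single trajectory. -/
lemma hasFDerivAt_trajProb {S A : Type*} {d H : ℕ} (p0 : S → ℝ) (P : S → A → S → ℝ)
    (pol : (Fin d → ℝ) → S → A → ℝ) (hpos : ∀ θ s a, 0 < pol θ s a)
    (hdiff : ∀ s a, Differentiable ℝ (fun θ => pol θ s a)) (θ : Fin d → ℝ) (τ : Traj S A H) :
    HasFDerivAt (fun θ' => trajProb p0 P pol θ' τ)
      (trajProb p0 P pol θ τ • ∑ t : Fin H,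
        fderiv ℝ (fun θ' => Real.log (pol θ' (trajState τ t.castSucc) (trajAction τ t))) θ)
      θ := by
  have h := (HasFDerivAt.finsetProd (u := Finset.univ) fun (t : Fin H) _ =>
    ((hdiff (trajState τ t.castSucc) (trajAction τ t)) θ).hasFDerivAt.mul_const
      (P (trajState τ t.castSucc) (trajAction τ t) (trajState τ t.succ))).const_mul
    (p0 (trajState τ 0))
  refine h.congr_fderiv ?_
  simp only [trajProb, mul_smul]
  congr 1
  rw [Finset.smul_sum]
  refine Finset.sum_congr rfl fun t _ => ?_
  rw [fderiv.log (hdiff _ _ θ) (hpos _ _ _).ne',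
    ← Finset.mul_prod_erase Finset.univ _ (Finset.mem_univ t), smul_smul, smul_smul]
  congr 1
  field_simp [(hpos θ (trajState τ t.castSucc) (trajAction τ t)).ne']

/-- The score function has mean zero under the policy. -/
lemma sum_policy_mul_fderiv_log_eq_zero {S A : Type*} [Fintype A] {d : ℕ}
    (pol : (Fin d → ℝ) → S → A → ℝ) (hpos : ∀ θ s a, 0 < pol θ s a)
    (hsum : ∀ θ s, ∑ a, pol θ s a = 1)
    (hdiff : ∀ s a, Differentiable ℝ (fun θ => pol θ s a)) (θ v : Fin d → ℝ) (s : S) :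
    ∑ a, pol θ s a * fderiv ℝ (fun θ' => Real.log (pol θ' s a)) θ v = 0 := by
  have h : ∀ a, pol θ s a * fderiv ℝ (fun θ' => Real.log (pol θ' s a)) θ v =
      fderiv ℝ (fun θ' => pol θ' s a) θ v := by
    intro a
    rw [fderiv.log (hdiff s a θ) (hpos θ s a).ne', _root_.smul_apply, smul_eq_mul,
      mul_inv_cancel_left₀ (hpos θ s a).ne']
  simp only [h]
  rw [← _root_.sum_apply, ← fderiv_fun_sum fun a _ => hdiff s a θ]
  simp [hsum]

lemma trajReturn_eq_returnToGo_add {S A : Type*} {H : ℕ} (r : S → A → ℝ) (γ : ℝ)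
    (τ : Traj S A H) (t : Fin H) :
    trajReturn r γ τ = returnToGo r γ τ t + ∑ u ∈ Finset.univ.filter (fun u : Fin H => u < t),
      γ ^ (u : ℕ) * r (trajState τ u.castSucc) (trajAction τ u) := by
  rw [trajReturn, returnToGo,
    ← Finset.sum_filter_add_sum_filter_not Finset.univ (fun u : Fin H => t ≤ u)]
  simp only [not_le]

/-- Policy Gradient Theorem, returns-to-go form:
`∇V(θ) = Σ_τ P_θ(τ) Σ_t ∇ log π_θ(a_t|s_t) · G_t(τ)`. -/
theorem policy_gradient_returns_to_go
    {S A : Type*} [Fintype S] [Fintype A] [DecidableEq A] [DecidableEq S]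
    [Nonempty S] [Nonempty A] {d : ℕ}
    (p0 : S → ℝ) (hp0 : ∀ s, 0 ≤ p0 s) (hp0sum : ∑ s, p0 s = 1)
    (P : S → A → S → ℝ) (hP : ∀ s a s', 0 ≤ P s a s')
    (hPsum : ∀ s a, ∑ s', P s a s' = 1)
    (r : S → A → ℝ) (H : ℕ) (γ : ℝ) (hγ : γ ∈ Set.Icc (0 : ℝ) 1)
    (pol : (Fin d → ℝ) → S → A → ℝ)
    (hpos : ∀ θ s a, 0 < pol θ s a) (hsum : ∀ θ s, ∑ a, pol θ s a = 1)
    (hdiff : ∀ s a, Differentiable ℝ (fun θ => pol θ s a))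
    (θ : Fin d → ℝ) :
    fderiv ℝ (value H p0 P pol r γ) θ =
      ∑ τ : Traj S A H,
        trajProb p0 P pol θ τ •
          ∑ t : Fin H,
            returnToGo r γ τ t •
              fderiv ℝ
                (fun θ' => Real.log (pol θ' (trajState τ t.castSucc) (trajAction τ t)))
                θ := by
  have hV : HasFDerivAt (value H p0 P pol r γ) _ θ :=
    HasFDerivAt.fun_sum (u := Finset.univ) fun (τ : Traj S A H) _ =>
      (hasFDerivAt_trajProb p0 P pol hpos hdiff θ τ).mul_const (trajReturn r γ τ)
  rw [hV.fderiv]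
  ext1 v
  rw [← sub_eq_zero]
  simp only [_root_.sum_apply, _root_.smul_apply, smul_eq_mul]
  rw [← Finset.sum_sub_distrib]
  have hτ : ∀ τ : Traj S A H,
      trajReturn r γ τ * (trajProb p0 P pol θ τ * ∑ t : Fin H, fderiv ℝ
          (fun θ' => Real.log (pol θ' (trajState τ t.castSucc) (trajAction τ t))) θ v) -
        trajProb p0 P pol θ τ * ∑ t : Fin H, returnToGo r γ τ t * fderiv ℝ
          (fun θ' => Real.log (pol θ' (trajState τ t.castSucc) (trajAction τ t))) θ v =
      ∑ t : Fin H, ∑ u ∈ Finset.univ.filter (fun u : Fin H => u < t),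
        trajProb p0 P pol θ τ *
          (γ ^ (u : ℕ) * r (trajState τ u.castSucc) (trajAction τ u) * fderiv ℝ
            (fun θ' => Real.log (pol θ' (trajState τ t.castSucc) (trajAction τ t))) θ v) := by
    intro τ
    rw [mul_left_comm, ← mul_sub, Finset.mul_sum, ← Finset.sum_sub_distrib, Finset.mul_sum]
    refine Finset.sum_congr rfl fun t _ => ?_
    rw [trajReturn_eq_returnToGo_add r γ τ t, ← sub_mul, add_sub_cancel_left, Finset.sum_mul,
      Finset.mul_sum]
  rw [Finset.sum_congr rfl fun τ _ => hτ τ, Finset.sum_comm]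
  refine Finset.sum_eq_zero fun t _ => ?_
  rw [Finset.sum_comm]
  refine Finset.sum_eq_zero fun u hu => ?_
  exact sum_trajProb_mul_earlier_mul_eq_zero p0 P hPsum pol θ (hsum θ)
    (fun s a => γ ^ (u : ℕ) * r s a)
    (fun s a => fderiv ℝ (fun θ' => Real.log (pol θ' s a)) θ v)
    (sum_policy_mul_fderiv_log_eq_zero pol hpos hsum hdiff θ v) (Finset.mem_filter.1 hu).2

end
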